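/- For every k ≥ 1 there exists θ_c > 0, depending only on k, with the following property for every pattern σ ∈ S_k and every μ ∈ ℳ: (a) for each θ ∈ (−θ_c,θ_c) the supremum defining F(σ,μ,θ) has a unique maximizer ν_θ ∈ ℳ; (b) the map θ ↦ t_σ(ν_θ) is continuous and non-decreasing on (−θ_c,θ_c); (c) the map θ ↦ F(σ,μ,θ) is differentiable on (−θ_c,θ_c) with derivative F′(σ,μ,θ) = t_σ(ν_θ); and (d) if θ₁,θ₂ ∈ (−θ_c,θ_c) satisfy t_σ(ν_{θ₁}) = t_σ(ν_{θ₂}), then ν_{θ₁} = ν_{θ₂}. -/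

import Mathlib

open MeasureTheory Filter Topology
open scoped ENNReal

noncomputable section

/-- The plane `ℝ²`, carrier for measures on the unit square. -/
abbrev Ω2 : Type := ℝ × ℝ

/-- The unit square `[0,1]² ⊆ ℝ²`. -/
def unitSq : Set Ω2 := Set.Icc (0 : ℝ) 1 ×ˢ Set.Icc (0 : ℝ) 1

/-- Lebesgue measure on the unit square. -/
def lebSq : Measure Ω2 := volume.restrict unitSq

/-- `𝒫`: Borel probability measures concentrated on the unit square. -/
def Pcal : Set (ProbabilityMeasure Ω2) := {μ | (μ : Measure Ω2) unitSq = 1}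

/-- `ℳ`: members of `𝒫` whose two coordinate marginals are atomless
(equivalently, have continuous CDFs). -/
def Mcal : Set (ProbabilityMeasure Ω2) :=
  {μ | μ ∈ Pcal ∧ (∀ x : ℝ, (μ : Measure Ω2).map Prod.fst {x} = 0) ∧
      ∀ y : ℝ, (μ : Measure Ω2).map Prod.snd {y} = 0}

/-- The uniform distribution on `[0,1]`. -/
def unif01 : Measure ℝ := volume.restrict (Set.Icc (0 : ℝ) 1)

/-- `ℳ̃`: permutons, i.e. members of `𝒫` with both marginals uniform on `[0,1]`. -/
def Mtilde : Set (ProbabilityMeasure Ω2) :=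
  {μ | μ ∈ Pcal ∧ (μ : Measure Ω2).map Prod.fst = unif01 ∧
      (μ : Measure Ω2).map Prod.snd = unif01}

open scoped Classical in
/-- `h_σ`: indicator that the `k` points induce the pattern `σ`. -/
def hPat {k : ℕ} (σ : Equiv.Perm (Fin k)) (z : Fin k → Ω2) : ℝ :=
  if ∃ τ : Equiv.Perm (Fin k),
      StrictMono (fun i => (z (τ i)).1) ∧ StrictMono (fun i => (z (τ (σ⁻¹ i))).2)
  then 1 else 0

/-- Pattern density `t_σ(ν) = ∫ h_σ dν^{⊗k}`. -/
def tPat {k : ℕ} (σ : Equiv.Perm (Fin k)) (ν : Measure Ω2) : ℝ :=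
  ∫ z, hPat σ z ∂(Measure.pi fun _ : Fin k => ν)

open scoped Classical in
/-- The permutation induced by `n` labelled points of `ℝ²` (junk value `1` if the
coordinates are not in generic position). -/
def inducedPerm {n : ℕ} (z : Fin n → Ω2) : Equiv.Perm (Fin n) :=
  if h : ∃ σ : Equiv.Perm (Fin n), hPat σ z = 1 then h.choose else 1

/-- Empirical measure `Em(π) = (1/n) ∑ δ_{(i/n, π(i)/n)}` of a permutation, as a measure. -/
def EmM {n : ℕ} (π : Equiv.Perm (Fin n)) : Measure Ω2 :=
  (n : ℝ≥0∞)⁻¹ • ∑ i : Fin n, Measure.dirac ((((i : ℕ) + 1 : ℝ)) / n, (((π i : ℕ) + 1 : ℝ)) / n)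

open scoped Classical in
/-- Empirical measure of a permutation as a probability measure (junk value for `n = 0`). -/
def EmP {n : ℕ} (π : Equiv.Perm (Fin n)) : ProbabilityMeasure Ω2 :=
  if h : IsProbabilityMeasure (EmM π) then ⟨EmM π, h⟩
  else ⟨Measure.dirac 0, by infer_instance⟩

/-- `t_σ(π) := t_σ(Em(π))`. -/
def tPerm {k n : ℕ} (σ : Equiv.Perm (Fin k)) (π : Equiv.Perm (Fin n)) : ℝ := tPat σ (EmM π)

open scoped Classical in
/-- Kullback–Leibler divergence `D(ν|μ) ∈ [0,∞]`; for probability measures with `ν ≪ μ`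
it equals `∫ log(dν/dμ) dν`, written here through the nonnegative integrand
`g log g + 1 - g` of the density `g = dν/dμ` (the correction `∫ (1-g) dμ = 0`). -/
def KL (ν μ : Measure Ω2) : ℝ≥0∞ :=
  if ν ≪ μ then
    ∫⁻ z, ENNReal.ofReal ((ν.rnDeriv μ z).toReal * Real.log ((ν.rnDeriv μ z).toReal)
      + 1 - (ν.rnDeriv μ z).toReal) ∂μ
  else ∞

/-- CDF of the first marginal. -/
def cdfX (μ : Measure Ω2) (x : ℝ) : ℝ := (μ {p : Ω2 | p.1 ≤ x}).toReal

/-- CDF of the second marginal. -/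
def cdfY (μ : Measure Ω2) (y : ℝ) : ℝ := (μ {p : Ω2 | p.2 ≤ y}).toReal

/-- The map `𝒪`: pushforward of `μ` under `(x,y) ↦ (F₁(x), F₂(y))`. -/
def Omap (μ : Measure Ω2) : Measure Ω2 := μ.map fun p => (cdfX μ p.1, cdfY μ p.2)

/-- The product measure `μ^{⊗n}` governing `n` i.i.d. samples. -/
def pmeas (μ : Measure Ω2) (n : ℕ) : Measure (Fin n → Ω2) := Measure.pi fun _ => μ

/-- Log-partition function `F_n(σ,μ,θ) = log E[exp(nθ t_σ(π_{n,μ}))]`. -/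
def Fn {k : ℕ} (σ : Equiv.Perm (Fin k)) (μ : Measure Ω2) (θ : ℝ) (n : ℕ) : ℝ :=
  Real.log (∫ z, Real.exp (n * θ * tPerm σ (inducedPerm z)) ∂pmeas μ n)

/-- The Gibbs measure `Q_{n,σ,μ,θ}` on `([0,1]²)ⁿ`. -/
def Qgibbs {k : ℕ} (σ : Equiv.Perm (Fin k)) (μ : Measure Ω2) (θ : ℝ) (n : ℕ) :
    Measure (Fin n → Ω2) :=
  (pmeas μ n).withDensity fun z =>
    ENNReal.ofReal (Real.exp (n * θ * tPerm σ (inducedPerm z) - Fn σ μ θ n))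

/-- `F(σ,μ,θ) = sup_{ν ∈ ℳ} { θ t_σ(ν) − D(ν|μ) }`, valued in `EReal`. -/
def Fsup {k : ℕ} (σ : Equiv.Perm (Fin k)) (μ : Measure Ω2) (θ : ℝ) : EReal :=
  ⨆ ν ∈ Mcal, (((θ * tPat σ (ν : Measure Ω2) : ℝ) : EReal) - ((KL (↑ν) μ : ℝ≥0∞) : EReal))

/-- `ℱ(σ,μ,θ)`: the set of maximizers of `ν ↦ θ t_σ(ν) − D(ν|μ)` over `ℳ`. -/
def Fset {k : ℕ} (σ : Equiv.Perm (Fin k)) (μ : Measure Ω2) (θ : ℝ) :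
    Set (ProbabilityMeasure Ω2) :=
  {ν | ν ∈ Mcal ∧
    (((θ * tPat σ (ν : Measure Ω2) : ℝ) : EReal) - ((KL (↑ν) μ : ℝ≥0∞) : EReal)) = Fsup σ μ θ}

/-- `G(σ,μ,δ) = inf { D(ν|μ) : ν ∈ ℳ, t_σ(ν) ≥ δ }`. -/
def Gfun {k : ℕ} (σ : Equiv.Perm (Fin k)) (μ : Measure Ω2) (δ : ℝ) : ℝ≥0∞ :=
  ⨅ ν ∈ {ν : ProbabilityMeasure Ω2 | ν ∈ Mcal ∧ δ ≤ tPat σ (ν : Measure Ω2)}, KL (↑ν) μ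

/-- `𝒢(σ,μ,δ)`: the set of minimizers in the definition of `G(σ,μ,δ)`. -/
def Gset {k : ℕ} (σ : Equiv.Perm (Fin k)) (μ : Measure Ω2) (δ : ℝ) :
    Set (ProbabilityMeasure Ω2) :=
  {ν | (ν ∈ Mcal ∧ δ ≤ tPat σ (ν : Measure Ω2)) ∧ KL (↑ν) μ = Gfun σ μ δ}

/-- `α_σ(μ) = inf {δ : G(σ,μ,δ) = ∞}`. -/
def alphaSig {k : ℕ} (σ : Equiv.Perm (Fin k)) (μ : Measure Ω2) : ℝ :=
  sInf {δ : ℝ | Gfun σ μ δ = ∞}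

/-- `μ` is conditionally constant (CC) with respect to a pattern `σ` of size `k+1`:
the conditional probability `P(π_{X,Y} = σ | (X₁,Y₁))`, which for i.i.d. samples equals
`z ↦ ∫ h_σ(z, w) dμ^{⊗k}(w)`, is `μ`-a.s. equal to a constant `c ∈ [0,1]`. -/
def IsCC {k : ℕ} (σ : Equiv.Perm (Fin (k + 1))) (μ : Measure Ω2) : Prop :=
  ∃ c ∈ Set.Icc (0 : ℝ) 1, ∀ᵐ z ∂μ,
    (∫ w : Fin k → Ω2, hPat σ (Fin.cons z w) ∂pmeas μ k) = c

/-- The inversion pattern `21 ∈ S₂`. -/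
def inv2 : Equiv.Perm (Fin 2) := Equiv.swap 0 1

/-- Lévy–Prokhorov (extended) distance between measures on `ℝ²`. -/
def dLPE (μ ν : Measure Ω2) : ℝ≥0∞ := levyProkhorovEDist μ ν

/-- The topological support of a measure: the points whose every open neighbourhood
has positive measure. -/
def msupport (μ : Measure Ω2) : Set Ω2 :=
  {z | ∀ U : Set Ω2, IsOpen U → z ∈ U → 0 < μ U}



open InformationTheory

lemma sq_sub_one_div_six_le_klFun {x : ℝ} (hx : 0 ≤ x) (hx2 : x ≤ 2) :
    (x - 1) ^ 2 / 6 ≤ klFun x := by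
  have key : (1 - √x) ^ 2 ≤ klFun x := by
    rcases hx.eq_or_lt with rfl | hpos
    · simp [klFun]
    · have h1 : 1 - (√x)⁻¹ ≤ Real.log √x := Real.one_sub_inv_le_log_of_pos (Real.sqrt_pos.2 hpos)
      rw [Real.log_sqrt hx] at h1
      have h2 := mul_le_mul_of_nonneg_left h1 hx
      have h3 : x * (√x)⁻¹ = √x := by
        rw [← div_eq_mul_inv, Real.div_sqrt]
      have h4 : √x ^ 2 = x := Real.sq_sqrt hx
      rw [klFun_apply]
      nlinarith
  refine le_trans ?_ key
  have h4 : √x ^ 2 = x := Real.sq_sqrt hx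
  have h5 : x - 1 = -((1 - √x) * (1 + √x)) := by rw [← h4]; simp; ring
  have h6 : (1 + √x) ^ 2 ≤ 6 := by nlinarith [sq_nonneg (1 - √x)]
  have h7 : (x - 1) ^ 2 = (1 - √x) ^ 2 * (1 + √x) ^ 2 := by rw [h5]; ring
  rw [h7]
  nlinarith [mul_le_mul_of_nonneg_left h6 (sq_nonneg (1 - √x))]

lemma klFun_midpoint_add_le {a b : ℝ} (ha : 0 ≤ a) (hb : 0 ≤ b) (l : ℝ) :
    2 * klFun ((a + b) / 2) + (2 * l * |a - b| - l ^ 2 * (a + b)) / 6 ≤ klFun a + klFun b := by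
  rcases (add_nonneg ha hb).eq_or_lt with h0 | hpos
  · obtain rfl : a = 0 := by linarith
    obtain rfl : b = 0 := by linarith
    simp [klFun]; norm_num
  set m := (a + b) / 2 with hm
  have hmpos : 0 < m := by positivity
  have hresc : ∀ x, 0 ≤ x → m * klFun (x / m) = x * Real.log x - x * Real.log m + m - x := by
    intro x hx
    rcases hx.eq_or_lt with rfl | hx
    · simp [klFun]
    · rw [klFun_apply, Real.log_div hx.ne' hmpos.ne']
      field_simp
  have hA := sq_sub_one_div_six_le_klFun (x := a / m) (by positivity)
    (by rw [div_le_iff₀ hmpos]; linarith)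
  have hB := sq_sub_one_div_six_le_klFun (x := b / m) (by positivity)
    (by rw [div_le_iff₀ hmpos]; linarith)
  have hA' := mul_le_mul_of_nonneg_left hA hmpos.le
  have hB' := mul_le_mul_of_nonneg_left hB hmpos.le
  rw [hresc a ha] at hA'
  rw [hresc b hb] at hB'
  have hq : m * ((a / m - 1) ^ 2 / 6) + m * ((b / m - 1) ^ 2 / 6) = (a - b) ^ 2 / (12 * m) := by
    have : b = 2 * m - a := by rw [hm]; ring
    rw [this]; field_simp; ring
  have hl : (2 * l * |a - b| - l ^ 2 * (a + b)) / 6 ≤ (a - b) ^ 2 / (12 * m) := by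
    rw [le_div_iff₀ (by positivity), ← sq_abs (a - b)]
    have : a + b = 2 * m := by rw [hm]; ring
    rw [this]
    nlinarith [sq_nonneg (|a - b| - 2 * m * l)]
  have hab : a + b = 2 * m := by rw [hm]; ring
  have : (a * Real.log m + b * Real.log m) = 2 * m * Real.log m := by rw [← hab]; ring
  simp only [klFun_apply]
  linarith

section ProductDensities

lemma prod_eval_succ {Ω : Type*} {n : ℕ} (f : Ω → ℝ) (z : Fin (n + 1) → Ω) :
    ∏ i, f (z i) = f (z 0) * ∏ i, f (Fin.tail z i) := Fin.prod_univ_succ _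

variable {Ω : Type*} [MeasurableSpace Ω] {μ : Measure Ω} [IsProbabilityMeasure μ]

lemma integrable_mul_tail {n : ℕ} {G : Ω → ℝ} {H : (Fin n → Ω) → ℝ} (hG : Integrable G μ)
    (hH : Integrable H (Measure.pi fun _ : Fin n => μ)) :
    Integrable (fun z : Fin (n + 1) → Ω => G (z 0) * H (Fin.tail z))
      (Measure.pi fun _ : Fin (n + 1) => μ) :=
  (measurePreserving_piFinSuccAbove (fun _ : Fin (n + 1) => μ) 0).integrable_comp_of_integrable
    (hG.mul_prod hH)

lemma integral_mul_tail {n : ℕ} (G : Ω → ℝ) (H : (Fin n → Ω) → ℝ) :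
    ∫ z : Fin (n + 1) → Ω, G (z 0) * H (Fin.tail z) ∂(Measure.pi fun _ : Fin (n + 1) => μ)
      = (∫ x, G x ∂μ) * ∫ w, H w ∂(Measure.pi fun _ : Fin n => μ) := by
  rw [← integral_prod_mul]
  exact (measurePreserving_piFinSuccAbove (fun _ : Fin (n + 1) => μ) 0).integral_comp'
    (fun p => G p.1 * H p.2)

lemma integrable_prod_eval {n : ℕ} {f : Ω → ℝ} (hf : Integrable f μ) :
    Integrable (fun z : Fin n → Ω => ∏ i, f (z i)) (Measure.pi fun _ : Fin n => μ) :=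
  Integrable.fintype_prod (fun _ => hf)

lemma integral_abs_prod_sub_prod_le {a b : Ω → ℝ} (ha : Integrable a μ) (hb : Integrable b μ)
    (ha0 : ∀ x, 0 ≤ a x) (hb0 : ∀ x, 0 ≤ b x) (ha1 : ∫ x, a x ∂μ = 1) (hb1 : ∫ x, b x ∂μ = 1)
    (n : ℕ) :
    ∫ z : Fin n → Ω, |∏ i, a (z i) - ∏ i, b (z i)| ∂(Measure.pi fun _ => μ)
      ≤ n * ∫ x, |a x - b x| ∂μ := by
  induction n with
  | zero => simp
  | succ n ih =>
    have hA := integrable_prod_eval (n := n) ha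
    have hB := integrable_prod_eval (n := n) hb
    have h1 := integrable_mul_tail (ha.sub hb).abs hA
    have h2 := integrable_mul_tail hb (hA.sub hB).abs
    calc ∫ z : Fin (n + 1) → Ω, |∏ i, a (z i) - ∏ i, b (z i)| ∂(Measure.pi fun _ => μ)
        ≤ ∫ z : Fin (n + 1) → Ω, (|a (z 0) - b (z 0)| * (∏ i, a (Fin.tail z i))
          + b (z 0) * |∏ i, a (Fin.tail z i) - ∏ i, b (Fin.tail z i)|)
            ∂(Measure.pi fun _ => μ) := by
          refine integral_mono ((integrable_prod_eval ha).sub (integrable_prod_eval hb)).abs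
            (h1.add h2) fun z => ?_
          simp only [prod_eval_succ]
          have hP : 0 ≤ ∏ i, a (Fin.tail z i) := Finset.prod_nonneg fun i _ => ha0 _
          generalize (∏ i, a (Fin.tail z i)) = A at *
          generalize (∏ i, b (Fin.tail z i)) = B at *
          calc |a (z 0) * A - b (z 0) * B| = |(a (z 0) - b (z 0)) * A + b (z 0) * (A - B)| := by
                congr 1; ring
            _ ≤ |(a (z 0) - b (z 0)) * A| + |b (z 0) * (A - B)| := abs_add_le _ _
            _ = _ := by rw [abs_mul, abs_mul, abs_of_nonneg hP, abs_of_nonneg (hb0 _)]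
      _ = (∫ x, |a x - b x| ∂μ) + ∫ z : Fin n → Ω, |∏ i, a (z i) - ∏ i, b (z i)|
            ∂(Measure.pi fun _ => μ) := by
          refine (integral_add h1 h2).trans ?_
          congr 1
          · refine (integral_mul_tail (fun x => |a x - b x|)
              (fun w : Fin n → Ω => ∏ i, a (w i))).trans ?_
            rw [integral_fintype_prod_eq_prod]
            simp [ha1]
          · refine (integral_mul_tail b
              (fun w : Fin n → Ω => |∏ i, a (w i) - ∏ i, b (w i)|)).trans ?_
            rw [hb1, one_mul]
      _ ≤ _ := by push_cast; linarith

lemma integral_abs_prod_second_difference_le {a b : Ω → ℝ} (ha : Integrable a μ)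
    (hb : Integrable b μ) (ha0 : ∀ x, 0 ≤ a x) (hb0 : ∀ x, 0 ≤ b x) (ha1 : ∫ x, a x ∂μ = 1)
    (hb1 : ∫ x, b x ∂μ = 1) (n : ℕ) :
    ∫ z : Fin n → Ω, |∏ i, a (z i) + ∏ i, b (z i) - 2 * ∏ i, ((a (z i) + b (z i)) / 2)|
        ∂(Measure.pi fun _ => μ)
      ≤ n ^ 2 * (∫ x, |a x - b x| ∂μ) ^ 2 := by
  have hm : Integrable (fun x => (a x + b x) / 2) μ := (ha.add hb).div_const 2
  have hm1 : ∫ x, (a x + b x) / 2 ∂μ = 1 := by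
    rw [integral_div, integral_add ha hb, ha1, hb1]; norm_num
  have hd : Integrable (fun x => |a x - b x| / 2) μ := (ha.sub hb).abs.div_const 2
  set L := ∫ x, |a x - b x| ∂μ with hL
  have hd1 : ∫ x, |a x - b x| / 2 ∂μ = L / 2 := by rw [integral_div]
  have hL0 : 0 ≤ L := integral_nonneg fun _ => abs_nonneg _
  induction n with
  | zero => norm_num
  | succ n ih =>
    have hA := integrable_prod_eval (n := n) ha
    have hB := integrable_prod_eval (n := n) hb
    have hM := integrable_prod_eval (n := n) hm
    have h1 := integrable_mul_tail hm ((hA.add hB).sub (hM.const_mul 2)).abs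
    have h2 := integrable_mul_tail hd (hA.sub hB).abs
    calc _ ≤ ∫ z : Fin (n + 1) → Ω, ((a (z 0) + b (z 0)) / 2 * |∏ i, a (Fin.tail z i)
            + ∏ i, b (Fin.tail z i) - 2 * ∏ i, ((a (Fin.tail z i) + b (Fin.tail z i)) / 2)|
          + |a (z 0) - b (z 0)| / 2 * |∏ i, a (Fin.tail z i) - ∏ i, b (Fin.tail z i)|)
            ∂(Measure.pi fun _ => μ) := by
          refine integral_mono (((integrable_prod_eval ha).add (integrable_prod_eval hb)).sub
            ((integrable_prod_eval hm).const_mul 2)).abs (h1.add h2) fun z => ?_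
          simp only [prod_eval_succ]
          rw [prod_eval_succ (fun x => (a x + b x) / 2)]
          generalize (∏ i, a (Fin.tail z i)) = A
          generalize (∏ i, b (Fin.tail z i)) = B
          generalize (∏ i, (a (Fin.tail z i) + b (Fin.tail z i)) / 2) = M
          have hpos : 0 ≤ (a (z 0) + b (z 0)) / 2 := by linarith [ha0 (z 0), hb0 (z 0)]
          calc _ = |(a (z 0) + b (z 0)) / 2 * (A + B - 2 * M)
                  + (a (z 0) - b (z 0)) / 2 * (A - B)| := by congr 1; ring
            _ ≤ |(a (z 0) + b (z 0)) / 2 * (A + B - 2 * M)|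
                  + |(a (z 0) - b (z 0)) / 2 * (A - B)| := abs_add_le _ _
            _ = _ := by rw [abs_mul, abs_mul, abs_of_nonneg hpos, abs_div, abs_two]
      _ = (∫ z : Fin n → Ω, |∏ i, a (z i) + ∏ i, b (z i) - 2 * ∏ i, ((a (z i) + b (z i)) / 2)|
            ∂(Measure.pi fun _ => μ)) + L / 2 * ∫ z : Fin n → Ω, |∏ i, a (z i) - ∏ i, b (z i)|
            ∂(Measure.pi fun _ => μ) := by
          refine (integral_add h1 h2).trans ?_
          congr 1
          · refine (integral_mul_tail (fun x => (a x + b x) / 2) (fun w : Fin n → Ω =>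
              |∏ i, a (w i) + ∏ i, b (w i) - 2 * ∏ i, ((a (w i) + b (w i)) / 2)|)).trans ?_
            rw [hm1, one_mul]
          · refine (integral_mul_tail (fun x => |a x - b x| / 2)
              (fun w : Fin n → Ω => |∏ i, a (w i) - ∏ i, b (w i)|)).trans ?_
            rw [hd1]
      _ ≤ n ^ 2 * L ^ 2 + L / 2 * (n * L) := by
          gcongr
          exact integral_abs_prod_sub_prod_le ha hb ha0 hb0 ha1 hb1 n
      _ ≤ _ := by
          push_cast
          nlinarith [mul_nonneg (Nat.cast_nonneg (α := ℝ) n) (sq_nonneg L), sq_nonneg L]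

lemma pi_withDensity_ofReal {n : ℕ} {f : Ω → ℝ} (hf : Integrable f μ)
    (hf0 : ∀ x, 0 ≤ f x) :
    Measure.pi (fun _ : Fin n => μ.withDensity fun x => ENNReal.ofReal (f x))
      = (Measure.pi fun _ : Fin n => μ).withDensity fun z => ENNReal.ofReal (∏ i, f (z i)) := by
  have : IsFiniteMeasure (μ.withDensity fun x => ENNReal.ofReal (f x)) :=
    isFiniteMeasure_withDensity_ofReal hf.2
  refine Measure.pi_eq fun s hs => ?_
  rw [withDensity_apply _ (MeasurableSet.univ_pi hs),
    ← lintegral_indicator (MeasurableSet.univ_pi hs)]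
  have h1 : ∀ z : Fin n → Ω, (Set.univ.pi s).indicator
      (fun z => ENNReal.ofReal (∏ i, f (z i))) z
        = ENNReal.ofReal (∏ i, (s i).indicator f (z i)) := by
    intro z
    by_cases hz : z ∈ Set.univ.pi s
    · rw [Set.indicator_of_mem hz]
      congr 1
      exact Finset.prod_congr rfl fun i _ => (Set.indicator_of_mem (hz i trivial) f).symm
    · rw [Set.indicator_of_notMem hz]
      simp only [Set.mem_pi, Set.mem_univ, true_implies, not_forall] at hz
      obtain ⟨i, hi⟩ := hz
      rw [Finset.prod_eq_zero (Finset.mem_univ i) (Set.indicator_of_notMem hi f),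
        ENNReal.ofReal_zero]
  simp_rw [h1]
  have hind : ∀ i x, 0 ≤ (s i).indicator f x := fun i x => Set.indicator_nonneg (fun x _ => hf0 x) x
  have hint : ∀ i, Integrable ((s i).indicator f) μ := fun i => hf.indicator (hs i)
  rw [← ofReal_integral_eq_lintegral_ofReal (Integrable.fintype_prod hint)
    (ae_of_all _ fun z => Finset.prod_nonneg fun i _ => hind i _),
    integral_fintype_prod_eq_prod, ENNReal.ofReal_prod_of_nonneg
      fun i _ => integral_nonneg (hind i)]
  refine Finset.prod_congr rfl fun i _ => ?_
  rw [ofReal_integral_eq_lintegral_ofReal (hint i) (ae_of_all _ (hind i)),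
    withDensity_apply _ (hs i), ← lintegral_indicator (hs i)]
  congr 1 with x
  by_cases hx : x ∈ s i <;> simp [hx]

end ProductDensities

section StrongConcavity

variable {X E : Type*} [NormedAddCommGroup E] {ρ : X → E}

/-- A function that is bounded above, strongly midpoint concave and upper semicontinuous along
convergent sequences has a maximizer, with quadratic growth around it. -/
lemma exists_maximizer_of_midpoint [CompleteSpace E] [Nonempty X] {J : X → ℝ} {c : ℝ} (hc : 0 < c)
    (hbdd : BddAbove (Set.range J))
    (hmid : ∀ a b, ∃ m, (J a + J b) / 2 + c * ‖ρ a - ρ b‖ ^ 2 ≤ J m)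
    (hclosed : ∀ (u : ℕ → X) (f : E) (r : ℝ), Tendsto (fun n => ρ (u n)) atTop (𝓝 f) →
      Tendsto (fun n => J (u n)) atTop (𝓝 r) → ∃ x, r ≤ J x) :
    ∃ x, ∀ y, J y + c * ‖ρ x - ρ y‖ ^ 2 ≤ J x := by
  set M := ⨆ x, J x with hM
  have hle : ∀ x, J x ≤ M := fun x => le_ciSup hbdd x
  have hex : ∀ n : ℕ, ∃ x, M - 1 / ((n : ℝ) + 1) < J x := fun n =>
    exists_lt_of_lt_ciSup (sub_lt_self _ (by positivity))
  choose u hu using hex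
  have hlim0 : Tendsto (fun n : ℕ => M - 1 / ((n : ℝ) + 1)) atTop (𝓝 M) := by
    simpa using tendsto_const_nhds.sub (tendsto_one_div_add_atTop_nhds_zero_nat (𝕜 := ℝ))
  have hJ : Tendsto (fun n => J (u n)) atTop (𝓝 M) :=
    tendsto_of_tendsto_of_tendsto_of_le_of_le hlim0 tendsto_const_nhds
      (fun n => (hu n).le) fun n => hle _
  have hcau : CauchySeq fun n => ρ (u n) := by
    refine Metric.cauchySeq_iff.2 fun ε hε => ?_
    have hpos : 0 < c * ε ^ 2 := by positivity
    obtain ⟨N, hN⟩ := (hJ.eventually (lt_mem_nhds (sub_lt_self M hpos))).exists_forall_of_atTop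
    refine ⟨N, fun m hm n hn => ?_⟩
    obtain ⟨x, hx⟩ := hmid (u m) (u n)
    have h1 : c * ‖ρ (u m) - ρ (u n)‖ ^ 2 < c * ε ^ 2 := by
      linarith [hle x, hN m hm, hN n hn]
    rw [dist_eq_norm]
    exact lt_of_pow_lt_pow_left₀ 2 hε.le (lt_of_mul_lt_mul_left h1 hc.le)
  obtain ⟨f, hf⟩ := cauchySeq_tendsto_of_complete hcau
  obtain ⟨x, hx⟩ := hclosed u f M hf hJ
  refine ⟨x, fun y => ?_⟩
  obtain ⟨m, hm⟩ := hmid x y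
  have h2 : 0 ≤ c * ‖ρ x - ρ y‖ ^ 2 := by positivity
  linarith [hle m, hle x]

lemma exists_maximizer_sub_of_midpoint [CompleteSpace E] [Nonempty X] {t D : X → ℝ}
    {K C c θ : ℝ} (hc : 0 < c)
    (hD0 : ∀ x, 0 ≤ D x) (ht : ∀ x, |t x| ≤ 1) (hlip : ∀ a b, |t a - t b| ≤ K * ‖ρ a - ρ b‖)
    (hmid : ∀ a b, ∃ m, 2 * D m + 4 * c * ‖ρ a - ρ b‖ ^ 2 ≤ D a + D b ∧
      |t a + t b - 2 * t m| ≤ C * ‖ρ a - ρ b‖ ^ 2)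
    (hclosed : ∀ (u : ℕ → X) (f : E) (r : ℝ), Tendsto (fun n => ρ (u n)) atTop (𝓝 f) →
      Tendsto (fun n => D (u n)) atTop (𝓝 r) → ∃ x, ρ x = f ∧ D x ≤ r)
    (hθ : |θ| * C ≤ 2 * c) :
    ∃ x, ∀ y, θ * t y - D y + c * ‖ρ x - ρ y‖ ^ 2 ≤ θ * t x - D x := by
  refine exists_maximizer_of_midpoint (J := fun x => θ * t x - D x) hc ?_ ?_ ?_
  · refine ⟨|θ|, ?_⟩
    rintro _ ⟨x, rfl⟩
    have h1 : θ * t x ≤ |θ| * 1 := (le_abs_self _).trans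
      ((abs_mul _ _).le.trans (mul_le_mul_of_nonneg_left (ht x) (abs_nonneg _)))
    have := hD0 x
    dsimp only
    linarith
  · intro a b
    obtain ⟨m, hm1, hm2⟩ := hmid a b
    refine ⟨m, ?_⟩
    have h1 : θ * (t a + t b - 2 * t m) ≤ |θ| * (C * ‖ρ a - ρ b‖ ^ 2) :=
      (le_abs_self _).trans
        ((abs_mul _ _).le.trans (mul_le_mul_of_nonneg_left hm2 (abs_nonneg _)))
    have h2 := mul_le_mul_of_nonneg_right hθ (sq_nonneg ‖ρ a - ρ b‖)
    linarith
  · intro u f r hu hJ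
    have hcau : CauchySeq fun n => t (u n) := by
      have hK : 0 < |K| + 1 := by positivity
      refine Metric.cauchySeq_iff.2 fun ε hε => ?_
      obtain ⟨N, hN⟩ := Metric.cauchySeq_iff.1 hu.cauchySeq (ε / (|K| + 1)) (by positivity)
      refine ⟨N, fun m hm n hn => ?_⟩
      have h1 := hN m hm n hn
      rw [dist_eq_norm, lt_div_iff₀ hK] at h1
      rw [Real.dist_eq]
      have := hlip (u m) (u n)
      nlinarith [norm_nonneg (ρ (u m) - ρ (u n)), le_abs_self K]
    obtain ⟨T, hT⟩ := cauchySeq_tendsto_of_complete hcau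
    have hDlim : Tendsto (fun n => D (u n)) atTop (𝓝 (θ * T - r)) := by
      refine ((hT.const_mul θ).sub hJ).congr fun n => ?_
      ring
    obtain ⟨x, hxf, hxD⟩ := hclosed u f _ hu hDlim
    have htx : Tendsto (fun n => t (u n)) atTop (𝓝 (t x)) := by
      rw [tendsto_iff_dist_tendsto_zero]
      refine squeeze_zero (fun _ => dist_nonneg) (fun n => hlip (u n) x) ?_
      have := (tendsto_iff_norm_sub_tendsto_zero.1 hu).const_mul K
      rw [hxf]
      simpa using this
    refine ⟨x, ?_⟩
    rw [← tendsto_nhds_unique hT htx]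
    linarith

/-- Stability of the maximizers of `θ * t - D` in the parameter `θ`. -/
lemma mul_sq_le_of_maximizers {t D : X → ℝ} {c θ₁ θ₂ : ℝ} {x₁ x₂ : X}
    (h₁ : ∀ y, θ₁ * t y - D y + c * ‖ρ x₁ - ρ y‖ ^ 2 ≤ θ₁ * t x₁ - D x₁)
    (h₂ : ∀ y, θ₂ * t y - D y + c * ‖ρ x₂ - ρ y‖ ^ 2 ≤ θ₂ * t x₂ - D x₂) :
    2 * c * ‖ρ x₁ - ρ x₂‖ ^ 2 ≤ (θ₁ - θ₂) * (t x₁ - t x₂) := by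
  have a := h₁ x₂
  have b := h₂ x₁
  rw [norm_sub_rev] at b
  linarith

lemma continuousOn_of_maximizers {t D : X → ℝ} {K c : ℝ} (hc : 0 < c)
    (hlip : ∀ a b, |t a - t b| ≤ K * ‖ρ a - ρ b‖) {s : Set ℝ} {x : ℝ → X}
    (hx : ∀ θ ∈ s, ∀ y, θ * t y - D y + c * ‖ρ (x θ) - ρ y‖ ^ 2 ≤ θ * t (x θ) - D (x θ)) :
    ContinuousOn (fun θ => t (x θ)) s := by
  have hL : LipschitzOnWith (Real.toNNReal (K ^ 2 / (2 * c))) (fun θ => t (x θ)) s := by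
    refine LipschitzOnWith.of_dist_le_mul fun θ₁ h₁ θ₂ h₂ => ?_
    rw [Real.coe_toNNReal _ (by positivity), Real.dist_eq, Real.dist_eq, div_mul_eq_mul_div,
      le_div_iff₀ (by positivity)]
    have key := mul_sq_le_of_maximizers (hx θ₁ h₁) (hx θ₂ h₂)
    have hl := hlip (x θ₁) (x θ₂)
    generalize ‖ρ (x θ₁) - ρ (x θ₂)‖ = d at *
    have hab : (θ₁ - θ₂) * (t (x θ₁) - t (x θ₂)) ≤ |θ₁ - θ₂| * |t (x θ₁) - t (x θ₂)| :=
      (le_abs_self _).trans (abs_mul _ _).le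
    have h0 : 0 ≤ |t (x θ₁) - t (x θ₂)| := abs_nonneg _
    have h00 : 0 ≤ |θ₁ - θ₂| := abs_nonneg _
    generalize |t (x θ₁) - t (x θ₂)| = T at *
    generalize |θ₁ - θ₂| = S at *
    rcases h0.eq_or_lt with rfl | hpos
    · simp; positivity
    · have h1 : T ^ 2 ≤ K ^ 2 * d ^ 2 := by
        rw [← mul_pow]; exact pow_le_pow_left₀ h0 hl 2
      have h2 : T * (T * (2 * c)) ≤ T * (K ^ 2 * S) := by
        nlinarith [mul_le_mul_of_nonneg_left (key.trans hab) (sq_nonneg K),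
          mul_le_mul_of_nonneg_right h1 hc.le]
      exact le_of_mul_le_mul_left h2 hpos
  exact hL.continuousOn

lemma hasDerivAt_of_maximizers {t D : X → ℝ} {s : Set ℝ} (hs : IsOpen s) {x : ℝ → X}
    (hx : ∀ θ ∈ s, ∀ y, θ * t y - D y ≤ θ * t (x θ) - D (x θ))
    (hcont : ContinuousOn (fun θ => t (x θ)) s) {θ : ℝ} (hθ : θ ∈ s) :
    HasDerivAt (fun τ => τ * t (x τ) - D (x τ)) (t (x θ)) θ := by
  rw [hasDerivAt_iff_isLittleO]
  refine Asymptotics.isLittleO_iff.2 fun ε hε => ?_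
  have hc := (hcont.continuousAt (hs.mem_nhds hθ)).tendsto
  filter_upwards [Metric.tendsto_nhds.1 hc ε hε, hs.mem_nhds hθ] with τ hτ hτs
  have h1 := hx θ hθ (x τ)
  have h2 := hx τ hτs (x θ)
  rw [Real.dist_eq] at hτ
  rw [Real.norm_eq_abs, Real.norm_eq_abs, smul_eq_mul]
  have h3 : 0 ≤ τ * t (x τ) - D (x τ) - (θ * t (x θ) - D (x θ)) - (τ - θ) * t (x θ) := by
    linarith
  have h4 : τ * t (x τ) - D (x τ) - (θ * t (x θ) - D (x θ)) - (τ - θ) * t (x θ)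
      ≤ (τ - θ) * (t (x τ) - t (x θ)) := by linarith
  rw [abs_of_nonneg h3]
  calc _ ≤ _ := h4
    _ ≤ |τ - θ| * |t (x τ) - t (x θ)| := (le_abs_self _).trans (abs_mul _ _).le
    _ ≤ |τ - θ| * ε := by gcongr
    _ = _ := mul_comm _ _

end StrongConcavity

section FiniteDivergence

variable {μ : Measure Ω2} {k : ℕ}

/-- The density of `ν` with respect to `μ`, as a real function. -/
def density (ν μ : Measure Ω2) (z : Ω2) : ℝ := (ν.rnDeriv μ z).toReal

lemma measurable_density (ν μ : Measure Ω2) : Measurable (density ν μ) :=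
  (Measure.measurable_rnDeriv ν μ).ennreal_toReal

lemma density_nonneg (ν μ : Measure Ω2) (z : Ω2) : 0 ≤ density ν μ z := ENNReal.toReal_nonneg

lemma klFun_density_nonneg (ν μ : Measure Ω2) (z : Ω2) : 0 ≤ klFun (density ν μ z) :=
  klFun_nonneg (density_nonneg ν μ z)

lemma integrable_density (ν : Measure Ω2) [IsFiniteMeasure ν] : Integrable (density ν μ) μ :=
  Measure.integrable_toReal_rnDeriv

lemma KL_eq_lintegral {ν : Measure Ω2} (h : ν ≪ μ) :
    KL ν μ = ∫⁻ z, ENNReal.ofReal (klFun (density ν μ z)) ∂μ := if_pos h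

lemma measurable_hPat (σ : Equiv.Perm (Fin k)) : Measurable (hPat σ) := by
  classical
  have hx : ∀ i : Fin k, Measurable fun z : Fin k → Ω2 => (z i).1 := fun i =>
    measurable_fst.comp (measurable_pi_apply i)
  have hy : ∀ i : Fin k, Measurable fun z : Fin k → Ω2 => (z i).2 := fun i =>
    measurable_snd.comp (measurable_pi_apply i)
  refine Measurable.ite ?_ measurable_const measurable_const
  have hlt : ∀ f : Fin k → (Fin k → Ω2) → ℝ, (∀ i, Measurable (f i)) →
      Measurable fun z => StrictMono fun i => f i z := fun f hf =>
    Measurable.forall fun i => Measurable.forall fun j => Measurable.forall fun _ =>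
      measurableSet_setOfPred.1 (measurableSet_lt (hf i) (hf j))
  exact measurableSet_setOfPred.2 (Measurable.exists fun τ =>
    (hlt _ fun i => hx (τ i)).and (hlt _ fun i => hy (τ (σ⁻¹ i))))

lemma abs_hPat_le_one (σ : Equiv.Perm (Fin k)) (z : Fin k → Ω2) : |hPat σ z| ≤ 1 := by
  unfold hPat
  split_ifs <;> simp

lemma integrable_hPat_mul (σ : Equiv.Perm (Fin k)) {G : (Fin k → Ω2) → ℝ}
    (hG : Integrable G (Measure.pi fun _ : Fin k => μ)) :
    Integrable (fun z => hPat σ z * G z) (Measure.pi fun _ : Fin k => μ) :=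
  hG.bdd_mul (measurable_hPat σ).aestronglyMeasurable (ae_of_all _ (abs_hPat_le_one σ))

lemma abs_tPat_le_one (σ : Equiv.Perm (Fin k)) (ν : Measure Ω2) [IsProbabilityMeasure ν] :
    |tPat σ ν| ≤ 1 := by
  have := norm_integral_le_of_norm_le_const (μ := Measure.pi fun _ : Fin k => ν)
    (f := hPat σ) (ae_of_all _ (abs_hPat_le_one σ))
  simpa [tPat] using this

lemma abs_integral_hPat_mul_le (σ : Equiv.Perm (Fin k)) {G : (Fin k → Ω2) → ℝ}
    (hG : Integrable G (Measure.pi fun _ : Fin k => μ)) :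
    |∫ z, hPat σ z * G z ∂(Measure.pi fun _ : Fin k => μ)|
      ≤ ∫ z, |G z| ∂(Measure.pi fun _ : Fin k => μ) := by
  refine abs_integral_le_integral_abs.trans
    (integral_mono (integrable_hPat_mul σ hG).abs hG.abs fun z => ?_)
  simp only [abs_mul]
  exact mul_le_of_le_one_left (abs_nonneg _) (abs_hPat_le_one σ z)

variable (μ) in
/-- Probability measures of finite Kullback–Leibler divergence from `μ`. -/
abbrev FiniteKL : Type :=
  {ν : ProbabilityMeasure Ω2 // (ν : Measure Ω2) ≪ μ ∧ KL (ν : Measure Ω2) μ ≠ ∞}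

lemma FiniteKL.integrable_klFun (ν : FiniteKL μ) :
    Integrable (fun z => klFun (density (ν.1 : Measure Ω2) μ z)) μ := by
  refine ⟨(measurable_klFun.comp (measurable_density _ _)).aestronglyMeasurable, ?_⟩
  rw [hasFiniteIntegral_iff_ofReal (ae_of_all _ (klFun_density_nonneg _ _)),
    ← KL_eq_lintegral ν.2.1]
  exact ν.2.2.lt_top

lemma FiniteKL.toReal_KL (ν : FiniteKL μ) :
    (KL (ν.1 : Measure Ω2) μ).toReal = ∫ z, klFun (density (ν.1 : Measure Ω2) μ z) ∂μ := by
  rw [KL_eq_lintegral ν.2.1, ← ofReal_integral_eq_lintegral_ofReal ν.integrable_klFun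
    (ae_of_all _ (klFun_density_nonneg _ _)), ENNReal.toReal_ofReal
    (integral_nonneg (klFun_density_nonneg _ _))]

/-- The density of a measure of finite divergence, as an element of `L¹(μ)`. -/
def FiniteKL.toL1 (ν : FiniteKL μ) : Ω2 →₁[μ] ℝ :=
  (integrable_density (μ := μ) (ν.1 : Measure Ω2)).toL1 _

lemma FiniteKL.norm_toL1_sub (ν₁ ν₂ : FiniteKL μ) : ‖ν₁.toL1 - ν₂.toL1‖
    = ∫ z, |density (ν₁.1 : Measure Ω2) μ z - density (ν₂.1 : Measure Ω2) μ z| ∂μ := by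
  rw [FiniteKL.toL1, FiniteKL.toL1, ← Integrable.toL1_sub, L1.norm_of_fun_eq_integral_norm]
  rfl

variable [IsProbabilityMeasure μ]

lemma integral_density {ν : Measure Ω2} [IsProbabilityMeasure ν] (h : ν ≪ μ) :
    ∫ z, density ν μ z ∂μ = 1 :=
  (Measure.integral_toReal_rnDeriv h).trans probReal_univ

lemma withDensity_density {ν : Measure Ω2} [IsFiniteMeasure ν] (h : ν ≪ μ) :
    μ.withDensity (fun z => ENNReal.ofReal (density ν μ z)) = ν := by
  conv_rhs => rw [← Measure.withDensity_rnDeriv_eq ν μ h]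
  refine withDensity_congr_ae ?_
  filter_upwards [Measure.rnDeriv_lt_top ν μ] with z hz
  exact ENNReal.ofReal_toReal hz.ne

/-- The pattern density of a measure with density `f` with respect to `μ`. -/
lemma tPat_withDensity (σ : Equiv.Perm (Fin k)) {f : Ω2 → ℝ} (hfm : Measurable f)
    (hf : Integrable f μ) (hf0 : ∀ x, 0 ≤ f x) :
    tPat σ (μ.withDensity fun z => ENNReal.ofReal (f z))
      = ∫ z, hPat σ z * ∏ i, f (z i) ∂(Measure.pi fun _ : Fin k => μ) := by
  have hm : Measurable fun z : Fin k → Ω2 => ∏ i, f (z i) :=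
    Finset.measurable_prod _ fun i _ => hfm.comp (measurable_pi_apply i)
  rw [tPat, pi_withDensity_ofReal hf hf0,
    integral_withDensity_eq_integral_toReal_smul hm.ennreal_ofReal
      (ae_of_all _ fun _ => ENNReal.ofReal_lt_top)]
  refine integral_congr_ae (ae_of_all _ fun z => ?_)
  dsimp only
  rw [ENNReal.toReal_ofReal (Finset.prod_nonneg fun i _ => hf0 _), smul_eq_mul, mul_comm]

lemma tPat_eq_integral_density (σ : Equiv.Perm (Fin k)) {ν : Measure Ω2} [IsProbabilityMeasure ν]
    (h : ν ≪ μ) :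
    tPat σ ν = ∫ z, hPat σ z * ∏ i, density ν μ (z i) ∂(Measure.pi fun _ : Fin k => μ) := by
  rw [← tPat_withDensity σ (measurable_density ν μ) (integrable_density ν) (density_nonneg ν μ),
    withDensity_density h]

lemma abs_tPat_sub_le (σ : Equiv.Perm (Fin k)) {ν₁ ν₂ : Measure Ω2} [IsProbabilityMeasure ν₁]
    [IsProbabilityMeasure ν₂] (h₁ : ν₁ ≪ μ) (h₂ : ν₂ ≪ μ) :
    |tPat σ ν₁ - tPat σ ν₂| ≤ k * ∫ z, |density ν₁ μ z - density ν₂ μ z| ∂μ := by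
  have i₁ := integrable_prod_eval (n := k) (integrable_density (μ := μ) ν₁)
  have i₂ := integrable_prod_eval (n := k) (integrable_density (μ := μ) ν₂)
  rw [tPat_eq_integral_density σ h₁, tPat_eq_integral_density σ h₂,
    ← integral_sub (integrable_hPat_mul σ i₁) (integrable_hPat_mul σ i₂)]
  simp_rw [← mul_sub]
  exact (abs_integral_hPat_mul_le σ (i₁.sub i₂)).trans
    (integral_abs_prod_sub_prod_le (integrable_density ν₁) (integrable_density ν₂)
      (density_nonneg _ _) (density_nonneg _ _) (integral_density h₁) (integral_density h₂) k)

lemma abs_tPat_second_difference_le (σ : Equiv.Perm (Fin k)) {ν₁ ν₂ ν : Measure Ω2}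
    [IsProbabilityMeasure ν₁] [IsProbabilityMeasure ν₂] [IsProbabilityMeasure ν]
    (h₁ : ν₁ ≪ μ) (h₂ : ν₂ ≪ μ)
    (hν : ν = μ.withDensity fun z => ENNReal.ofReal ((density ν₁ μ z + density ν₂ μ z) / 2)) :
    |tPat σ ν₁ + tPat σ ν₂ - 2 * tPat σ ν|
      ≤ k ^ 2 * (∫ z, |density ν₁ μ z - density ν₂ μ z| ∂μ) ^ 2 := by
  have hm : Integrable (fun z => (density ν₁ μ z + density ν₂ μ z) / 2) μ :=
    ((integrable_density ν₁).add (integrable_density ν₂)).div_const 2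
  have i₁ := integrable_prod_eval (n := k) (integrable_density (μ := μ) ν₁)
  have i₂ := integrable_prod_eval (n := k) (integrable_density (μ := μ) ν₂)
  have i₃ := integrable_prod_eval (n := k) hm
  have htν := tPat_withDensity (f := fun z => (density ν₁ μ z + density ν₂ μ z) / 2) σ
    (((measurable_density ν₁ μ).add (measurable_density ν₂ μ)).div_const 2) hm
    fun z => by linarith [density_nonneg ν₁ μ z, density_nonneg ν₂ μ z]
  rw [hν]
  refine le_trans (le_of_eq ?_) ((abs_integral_hPat_mul_le σ ((i₁.add i₂).sub
    (i₃.const_mul 2))).trans (integral_abs_prod_second_difference_le (integrable_density ν₁)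
      (integrable_density ν₂) (density_nonneg _ _) (density_nonneg _ _) (integral_density h₁)
      (integral_density h₂) k))
  refine congrArg abs ?_
  rw [tPat_eq_integral_density σ h₁, tPat_eq_integral_density σ h₂, htν,
    ← integral_const_mul, ← integral_add (integrable_hPat_mul σ i₁) (integrable_hPat_mul σ i₂)]
  refine (integral_sub ((integrable_hPat_mul σ i₁).add (integrable_hPat_mul σ i₂))
    ((integrable_hPat_mul σ i₃).const_mul 2)).symm.trans ?_
  refine integral_congr_ae (ae_of_all _ fun z => ?_)
  simp only [Pi.add_apply, Pi.sub_apply]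
  ring

lemma FiniteKL.toL1_injective : Function.Injective (FiniteKL.toL1 (μ := μ)) := by
  intro ν₁ ν₂ h
  have hae := (Integrable.toL1_eq_toL1_iff _ _ _ _).1 h
  exact Subtype.ext (Subtype.ext ((withDensity_density ν₁.2.1).symm.trans
    ((withDensity_congr_ae (hae.mono fun z hz => congrArg ENNReal.ofReal hz)).trans
      (withDensity_density ν₂.2.1))))

lemma FiniteKL.exists_of_density {f : Ω2 → ℝ} (hfm : Measurable f) (hf0 : ∀ z, 0 ≤ f z)
    (hf : Integrable f μ) (hf1 : ∫ z, f z ∂μ = 1) (hfk : Integrable (fun z => klFun (f z)) μ) :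
    ∃ ν : FiniteKL μ, (ν.1 : Measure Ω2) = μ.withDensity (fun z => ENNReal.ofReal (f z)) ∧
      density (ν.1 : Measure Ω2) μ =ᵐ[μ] f := by
  set ν : Measure Ω2 := μ.withDensity fun z => ENNReal.ofReal (f z) with hν
  have hprob : IsProbabilityMeasure ν := by
    refine ⟨?_⟩
    rw [hν, withDensity_apply _ MeasurableSet.univ, Measure.restrict_univ,
      ← ofReal_integral_eq_lintegral_ofReal hf (ae_of_all _ hf0), hf1, ENNReal.ofReal_one]
  have hac : ν ≪ μ := withDensity_absolutelyContinuous _ _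
  have hdens : density ν μ =ᵐ[μ] f := by
    filter_upwards [Measure.rnDeriv_withDensity μ hfm.ennreal_ofReal] with z hz
    rw [density, hν, hz, ENNReal.toReal_ofReal (hf0 z)]
  refine ⟨⟨⟨ν, hprob⟩, hac, ?_⟩, rfl, hdens⟩
  have hKL : KL ν μ = ∫⁻ z, ENNReal.ofReal (klFun (f z)) ∂μ := by
    rw [KL_eq_lintegral hac]
    exact lintegral_congr_ae (hdens.mono fun z hz => by simp only [hz])
  change KL ν μ ≠ ∞
  rw [hKL, ← ofReal_integral_eq_lintegral_ofReal hfk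
    (ae_of_all _ fun z => klFun_nonneg (hf0 z))]
  exact ENNReal.ofReal_ne_top

lemma FiniteKL.exists_midpoint (σ : Equiv.Perm (Fin k)) (a b : FiniteKL μ) :
    ∃ m : FiniteKL μ, 2 * (KL (m.1 : Measure Ω2) μ).toReal + 4 * (1 / 48) * ‖a.toL1 - b.toL1‖ ^ 2
        ≤ (KL (a.1 : Measure Ω2) μ).toReal + (KL (b.1 : Measure Ω2) μ).toReal ∧
      |tPat σ (a.1 : Measure Ω2) + tPat σ (b.1 : Measure Ω2) - 2 * tPat σ (m.1 : Measure Ω2)|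
        ≤ (k : ℝ) ^ 2 * ‖a.toL1 - b.toL1‖ ^ 2 := by
  set α := density (a.1 : Measure Ω2) μ with hα
  set β := density (b.1 : Measure Ω2) μ with hβ
  have hα0 : ∀ z, 0 ≤ α z := density_nonneg _ _
  have hβ0 : ∀ z, 0 ≤ β z := density_nonneg _ _
  have hαm : Measurable α := measurable_density _ _
  have hβm : Measurable β := measurable_density _ _
  have hαi : Integrable α μ := integrable_density _
  have hβi : Integrable β μ := integrable_density _
  have hα1 : ∫ z, α z ∂μ = 1 := integral_density a.2.1
  have hβ1 : ∫ z, β z ∂μ = 1 := integral_density b.2.1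
  have hαk : Integrable (fun z => klFun (α z)) μ := a.integrable_klFun
  have hβk : Integrable (fun z => klFun (β z)) μ := b.integrable_klFun
  have hmm : Measurable fun z => (α z + β z) / 2 := (hαm.add hβm).div_const 2
  have hm0 : ∀ z, 0 ≤ (α z + β z) / 2 := fun z => by linarith [hα0 z, hβ0 z]
  have hmi : Integrable (fun z => (α z + β z) / 2) μ := (hαi.add hβi).div_const 2
  have hm1 : ∫ z, (α z + β z) / 2 ∂μ = 1 := by
    rw [integral_div, integral_add hαi hβi, hα1, hβ1]; norm_num
  have hmk : Integrable (fun z => klFun ((α z + β z) / 2)) μ := by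
    refine Integrable.mono' (hαk.add hβk) (measurable_klFun.comp hmm).aestronglyMeasurable
      (ae_of_all _ fun z => ?_)
    have h := klFun_midpoint_add_le (hα0 z) (hβ0 z) 0
    have h' := klFun_nonneg (hm0 z)
    rw [Real.norm_eq_abs, abs_of_nonneg h', Pi.add_apply]
    linarith
  obtain ⟨m, hm, hmd⟩ := FiniteKL.exists_of_density hmm hm0 hmi hm1 hmk
  refine ⟨m, ?_, ?_⟩
  · rw [FiniteKL.norm_toL1_sub, a.toReal_KL, b.toReal_KL, m.toReal_KL]
    have hmKL : ∫ z, klFun (density (m.1 : Measure Ω2) μ z) ∂μ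
        = ∫ z, klFun ((α z + β z) / 2) ∂μ :=
      integral_congr_ae (hmd.mono fun z hz => by simp only [hz])
    rw [hmKL, ← hα, ← hβ]
    set L := ∫ z, |α z - β z| ∂μ with hL
    have hdi : Integrable (fun z => 2 * (L / 2) * |α z - β z|) μ :=
      (hαi.sub hβi).abs.const_mul _
    have hsi : Integrable (fun z => (L / 2) ^ 2 * (α z + β z)) μ := (hαi.add hβi).const_mul _
    have hqi : Integrable (fun z => (2 * (L / 2) * |α z - β z| - (L / 2) ^ 2 * (α z + β z)) / 6) μ :=
      (hdi.sub hsi).div_const 6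
    have h1 : ∫ z, (2 * klFun ((α z + β z) / 2)
        + (2 * (L / 2) * |α z - β z| - (L / 2) ^ 2 * (α z + β z)) / 6) ∂μ
          ≤ ∫ z, (klFun (α z) + klFun (β z)) ∂μ :=
      integral_mono ((hmk.const_mul 2).add hqi) (hαk.add hβk)
        fun z => klFun_midpoint_add_le (hα0 z) (hβ0 z) (L / 2)
    rw [integral_add hαk hβk, integral_add (hmk.const_mul 2) hqi,
      integral_div, integral_sub hdi hsi, integral_const_mul, integral_const_mul,
      integral_const_mul, integral_add hαi hβi, hα1, hβ1] at h1
    rw [← hL] at h1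
    linarith
  · rw [FiniteKL.norm_toL1_sub]
    exact abs_tPat_second_difference_le σ a.2.1 b.2.1 hm

lemma FiniteKL.exists_limit (u : ℕ → FiniteKL μ) (f : Ω2 →₁[μ] ℝ) (r : ℝ)
    (hu : Tendsto (fun n => (u n).toL1) atTop (𝓝 f))
    (hr : Tendsto (fun n => (KL ((u n).1 : Measure Ω2) μ).toReal) atTop (𝓝 r)) :
    ∃ ν : FiniteKL μ, ν.toL1 = f ∧ (KL (ν.1 : Measure Ω2) μ).toReal ≤ r := by
  obtain ⟨ns, hns, hae⟩ := (tendstoInMeasure_of_tendsto_Lp hu).exists_seq_tendsto_ae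
  have hcoe : ∀ᵐ z ∂μ, ∀ n, (u n).toL1 z = density ((u n).1 : Measure Ω2) μ z :=
    ae_all_iff.2 fun n => Integrable.coeFn_toL1 _
  have hlim : ∀ᵐ z ∂μ, Tendsto (fun i => density ((u (ns i)).1 : Measure Ω2) μ z) atTop
      (𝓝 (f z)) := by
    filter_upwards [hae, hcoe] with z hz hc
    exact hz.congr fun i => hc _
  set g : Ω2 → ℝ := fun z => max (f z) 0 with hg
  have hgm : Measurable g := (Lp.stronglyMeasurable f).measurable.max measurable_const
  have hg0 : ∀ z, 0 ≤ g z := fun z => le_max_right _ _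
  have hgf : g =ᵐ[μ] f := by
    filter_upwards [hlim] with z hz
    exact max_eq_left (ge_of_tendsto' hz fun i => density_nonneg _ _ _)
  have hgi : Integrable g μ := (L1.integrable_coeFn f).congr hgf.symm
  have hg1 : ∫ z, g z ∂μ = 1 := by
    rw [integral_congr_ae hgf]
    refine tendsto_nhds_unique ((continuous_integral.tendsto f).comp hu)
      (tendsto_const_nhds.congr fun n => ?_)
    rw [Function.comp_apply, ← integral_density (u n).2.1]
    exact integral_congr_ae (Integrable.coeFn_toL1 _).symm
  have hfatou : ∫⁻ z, ENNReal.ofReal (klFun (g z)) ∂μ ≤ ENNReal.ofReal r := by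
    have hrs : Tendsto (fun i => ∫⁻ z, ENNReal.ofReal
        (klFun (density ((u (ns i)).1 : Measure Ω2) μ z)) ∂μ) atTop (𝓝 (ENNReal.ofReal r)) := by
      refine (ENNReal.tendsto_ofReal (hr.comp hns.tendsto_atTop)).congr fun i => ?_
      rw [Function.comp_apply, ENNReal.ofReal_toReal (u (ns i)).2.2,
        KL_eq_lintegral (u (ns i)).2.1]
    rw [← hrs.liminf_eq]
    refine le_trans (le_of_eq (lintegral_congr_ae ?_)) (lintegral_liminf_le fun i =>
      (measurable_klFun.comp (measurable_density _ _)).ennreal_ofReal)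
    filter_upwards [hlim, hgf] with z hz hgz
    rw [hgz]
    exact ((ENNReal.tendsto_ofReal ((continuous_klFun.tendsto _).comp hz)).liminf_eq).symm
  have hgk : Integrable (fun z => klFun (g z)) μ := by
    refine ⟨(measurable_klFun.comp hgm).aestronglyMeasurable, ?_⟩
    rw [hasFiniteIntegral_iff_ofReal (ae_of_all _ fun z => klFun_nonneg (hg0 z))]
    exact hfatou.trans_lt ENNReal.ofReal_lt_top
  obtain ⟨ν, -, hνd⟩ := FiniteKL.exists_of_density hgm hg0 hgi hg1 hgk
  refine ⟨ν, ?_, ?_⟩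
  · refine Lp.ext ?_
    exact (Integrable.coeFn_toL1 _).trans (hνd.trans hgf)
  · refine ENNReal.toReal_le_of_le_ofReal
      (ge_of_tendsto' hr fun n => ENNReal.toReal_nonneg) (le_trans (le_of_eq ?_) hfatou)
    rw [KL_eq_lintegral ν.2.1]
    exact lintegral_congr_ae (hνd.mono fun z hz => by simp only [hz])

lemma mem_Mcal_of_absolutelyContinuous {μ ν : ProbabilityMeasure Ω2} (hμ : μ ∈ Mcal)
    (h : (ν : Measure Ω2) ≪ μ) : ν ∈ Mcal := by
  obtain ⟨h1, h2, h3⟩ := hμ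
  refine ⟨?_, fun x => h.map measurable_fst (h2 x), fun y => h.map measurable_snd (h3 y)⟩
  have hms : MeasurableSet unitSq := measurableSet_Icc.prod measurableSet_Icc
  exact (prob_compl_eq_zero_iff hms).1 (h ((prob_compl_eq_zero_iff hms).2 h1))

lemma KL_self (μ : Measure Ω2) [IsProbabilityMeasure μ] : KL μ μ = 0 := by
  rw [KL_eq_lintegral Measure.AbsolutelyContinuous.rfl]
  refine (lintegral_eq_zero_iff
    (measurable_klFun.comp (measurable_density μ μ)).ennreal_ofReal).2 ?_
  filter_upwards [Measure.rnDeriv_self μ] with z hz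
  simp [density, hz, klFun_one]

end FiniteDivergence

/-- Theorem 1.10 (i)–(iii): for every `k` there is `θ_c > 0` depending only
on `k` such that for all `σ ∈ S_k`, `μ ∈ ℳ`: (a) for each `θ ∈ (−θ_c,θ_c)` there is a unique
maximizer `ν_θ`; (b) `θ ↦ t_σ(ν_θ)` is continuous and non-decreasing; (c) `θ ↦ F(σ,μ,θ)` is
differentiable with derivative `t_σ(ν_θ)`; (d) `t_σ(ν_{θ₁}) = t_σ(ν_{θ₂}) → ν_{θ₁} = ν_{θ₂}`. -/
theorem gibbs_high_temperature_properties (k : ℕ) :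
    ∃ θc > (0 : ℝ), ∀ (σ : Equiv.Perm (Fin k)) (μ : ProbabilityMeasure Ω2), μ ∈ Mcal →
      ∃ ν : ℝ → ProbabilityMeasure Ω2,
        (∀ θ ∈ Set.Ioo (-θc) θc, Fset σ (↑μ) θ = {ν θ}) ∧
        ContinuousOn (fun θ => tPat σ ((ν θ : Measure Ω2))) (Set.Ioo (-θc) θc) ∧
        MonotoneOn (fun θ => tPat σ ((ν θ : Measure Ω2))) (Set.Ioo (-θc) θc) ∧
        (∀ θ ∈ Set.Ioo (-θc) θc,
          HasDerivAt (fun t : ℝ => (Fsup σ (↑μ) t).toReal) (tPat σ ((ν θ : Measure Ω2))) θ) ∧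
        ∀ θ₁ ∈ Set.Ioo (-θc) θc, ∀ θ₂ ∈ Set.Ioo (-θc) θc,
          tPat σ ((ν θ₁ : Measure Ω2)) = tPat σ ((ν θ₂ : Measure Ω2)) → ν θ₁ = ν θ₂ := by
  obtain ⟨c, hc, hc48⟩ : ∃ c : ℝ, 0 < c ∧ c = 1 / 48 := ⟨_, by norm_num, rfl⟩
  refine ⟨2 * c / ((k : ℝ) ^ 2 + 1), by positivity, fun σ μ hμ => ?_⟩
  set s := Set.Ioo (-(2 * c / ((k : ℝ) ^ 2 + 1))) (2 * c / ((k : ℝ) ^ 2 + 1)) with hs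
  let t : FiniteKL (μ : Measure Ω2) → ℝ := fun ν => tPat σ (ν.1 : Measure Ω2)
  let D : FiniteKL (μ : Measure Ω2) → ℝ := fun ν => (KL (ν.1 : Measure Ω2) μ).toReal
  have : Nonempty (FiniteKL (μ : Measure Ω2)) :=
    ⟨⟨μ, Measure.AbsolutelyContinuous.rfl, by rw [KL_self]; exact ENNReal.zero_ne_top⟩⟩
  have hlip : ∀ a b : FiniteKL (μ : Measure Ω2), |t a - t b| ≤ k * ‖a.toL1 - b.toL1‖ :=
    fun a b => by
      rw [FiniteKL.norm_toL1_sub]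
      exact abs_tPat_sub_le σ a.2.1 b.2.1
  have hmax : ∀ θ, ∃ x : FiniteKL (μ : Measure Ω2), θ ∈ s →
      ∀ y, θ * t y - D y + c * ‖x.toL1 - y.toL1‖ ^ 2 ≤ θ * t x - D x := by
    intro θ
    by_cases hθ : θ ∈ s
    · have hθ' : |θ| * (k : ℝ) ^ 2 ≤ 2 * c := by
        have h1 := abs_lt.2 ⟨hθ.1, hθ.2⟩
        rw [lt_div_iff₀ (by positivity)] at h1
        linarith [abs_nonneg θ]
      obtain ⟨x, hx⟩ := exists_maximizer_sub_of_midpoint (ρ := FiniteKL.toL1) (t := t) (D := D) hc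
        (fun _ => ENNReal.toReal_nonneg) (fun ν => abs_tPat_le_one σ _) hlip
        (hc48 ▸ FiniteKL.exists_midpoint σ) FiniteKL.exists_limit hθ'
      exact ⟨x, fun _ => hx⟩
    · exact ⟨Classical.arbitrary _, fun h => absurd h hθ⟩
  choose x hx using hmax
  have hx' : ∀ θ ∈ s, ∀ y, θ * t y - D y ≤ θ * t (x θ) - D (x θ) := fun θ hθ y => by
    have := hx θ hθ y
    have h0 : 0 ≤ c * ‖(x θ).toL1 - y.toL1‖ ^ 2 := by positivity
    linarith
  have hcoe : ∀ (θ : ℝ) (y : FiniteKL (μ : Measure Ω2)),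
      (((θ * tPat σ (y.1 : Measure Ω2) : ℝ) : EReal) - ((KL (y.1 : Measure Ω2) μ : ℝ≥0∞) : EReal))
        = ((θ * t y - D y : ℝ) : EReal) := by
    intro θ y
    rw [EReal.coe_sub, EReal.coe_ennreal_toReal y.2.2]
  have hcases : ∀ (θ : ℝ) (ν : ProbabilityMeasure Ω2),
      (((θ * tPat σ (ν : Measure Ω2) : ℝ) : EReal) - ((KL (ν : Measure Ω2) μ : ℝ≥0∞) : EReal)) = ⊥ ∨
        ∃ y : FiniteKL (μ : Measure Ω2), y.1 = ν := by
    intro θ ν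
    by_cases h : KL (ν : Measure Ω2) μ = ∞
    · exact Or.inl (by rw [h]; simp)
    · refine Or.inr ⟨⟨ν, ?_, h⟩, rfl⟩
      by_contra hac
      exact h (if_neg hac)
  have hF : ∀ θ ∈ s, Fsup σ (μ : Measure Ω2) θ = ((θ * t (x θ) - D (x θ) : ℝ) : EReal) := by
    intro θ hθ
    refine le_antisymm (iSup₂_le fun ν _ => ?_) ?_
    · rcases hcases θ ν with h | ⟨y, rfl⟩
      · rw [h]; exact bot_le
      · rw [hcoe]; exact EReal.coe_le_coe_iff.2 (hx' θ hθ y)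
    · rw [← hcoe]
      exact le_iSup₂_of_le (x θ).1 (mem_Mcal_of_absolutelyContinuous hμ (x θ).2.1) le_rfl
  have hcont : ContinuousOn (fun θ => t (x θ)) s := continuousOn_of_maximizers hc hlip hx
  refine ⟨fun θ => (x θ).1, fun θ hθ => ?_, hcont, fun θ₁ h₁ θ₂ h₂ h12 => ?_, fun θ hθ => ?_,
    fun θ₁ h₁ θ₂ h₂ h12 => ?_⟩
  · refine Set.eq_singleton_iff_unique_mem.2
      ⟨⟨mem_Mcal_of_absolutelyContinuous hμ (x θ).2.1, by rw [hcoe, hF θ hθ]⟩, ?_⟩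
    rintro ν ⟨-, hν⟩
    rw [hF θ hθ] at hν
    rcases hcases θ ν with h | ⟨y, rfl⟩
    · rw [h] at hν
      exact absurd hν.symm (EReal.coe_ne_bot _)
    · rw [hcoe] at hν
      have h1 := EReal.coe_eq_coe_iff.1 hν
      have h2 := hx θ hθ y
      have h3 : c * ‖(x θ).toL1 - y.toL1‖ ^ 2 = 0 := le_antisymm (by linarith) (by positivity)
      have h4 := norm_sub_eq_zero_iff.1
        (pow_eq_zero_iff two_ne_zero |>.1 ((mul_eq_zero.1 h3).resolve_left hc.ne'))
      exact congrArg Subtype.val (FiniteKL.toL1_injective h4).symm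
  · have h := (mul_nonneg (by positivity) (sq_nonneg _)).trans
      (mul_sq_le_of_maximizers (hx θ₂ h₂) (hx θ₁ h₁))
    rcases h12.eq_or_lt with rfl | hlt
    · exact le_rfl
    · exact sub_nonneg.1 (nonneg_of_mul_nonneg_right h (sub_pos.2 hlt))
  · refine (hasDerivAt_of_maximizers isOpen_Ioo hx' hcont hθ).congr_of_eventuallyEq ?_
    filter_upwards [isOpen_Ioo.mem_nhds hθ] with τ hτ
    rw [hF τ hτ, EReal.toReal_coe]
  · have h := mul_sq_le_of_maximizers (hx θ₁ h₁) (hx θ₂ h₂)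
    have h12' : t (x θ₁) = t (x θ₂) := h12
    rw [h12', sub_self, mul_zero] at h
    have h3 : 2 * c * ‖(x θ₁).toL1 - (x θ₂).toL1‖ ^ 2 = 0 := le_antisymm h (by positivity)
    have h4 := norm_sub_eq_zero_iff.1
      (pow_eq_zero_iff two_ne_zero |>.1 ((mul_eq_zero.1 h3).resolve_left (by positivity)))
    exact congrArg Subtype.val (FiniteKL.toL1_injective h4)

end
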